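/- arXiv:0704.2019 — 4 statements merged into one kernel-verified Lean document; each statement's English description precedes it below -/
import Mathlib

section
/- Let δt be a positive infinitesimal hyperreal and let v be the positive hyperreal with v² = δt. Let σ be a positive, limited and appreciable hyperreal, and let u be a hyperreal such that u²/δt − σ² is infinitesimal. Then there exists ε ∈ {−1, 1} such that u/v − ε·σ is infinitesimal. -/
open Hyperreal

set_option linter.deprecated false

/-- If a product of two hyperreals is infinitesimal, then so is one of the factors. -/
theorem Hyperreal.Infinitesimal.or_of_mul {x y : ℝ*} (h : Infinitesimal (x * y)) :
    Infinitesimal x ∨ Infinitesimal y := by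
  simp only [infinitesimal_iff, ArchimedeanClass.mk_mul] at h ⊢
  contrapose! h
  exact add_nonpos h.1 h.2

/-- If `δt` is a positive infinitesimal, `v > 0` satisfies `v² = δt`, `σ` is a positive
limited (non-infinite) and appreciable (non-infinitesimal) hyperreal, and the Heisenberg
condition `u²/δt ≈ σ²` holds, then there is a sign `ε = ±1` with `u/v ≈ ε·σ`. -/
theorem heisenberg_sign (δt v σ u : ℝ*)
    (hδt_pos : 0 < δt) (hδt_inf : Infinitesimal δt)
    (hv_pos : 0 < v) (hv_sq : v ^ 2 = δt)
    (hσ_pos : 0 < σ) (hσ_lim : ¬ σ.Infinite) (hσ_app : ¬ Infinitesimal σ)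
    (hu : Infinitesimal (u ^ 2 / δt - σ ^ 2)) :
    ∃ sgn : ℝ*, (sgn = -1 ∨ sgn = 1) ∧ Infinitesimal (u / v - sgn * σ) := by
  subst hv_sq
  have hfactor : u ^ 2 / v ^ 2 - σ ^ 2 = (u / v + σ) * (u / v - σ) := by
    rw [← div_pow, sq_sub_sq]
  rw [hfactor] at hu
  rcases hu.or_of_mul with h | h
  · exact ⟨-1, Or.inl rfl, by simpa using h⟩
  · exact ⟨1, Or.inr rfl, by simpa using h⟩
end

section
/- Let δt be a positive infinitesimal hyperreal, let σ be a positive, limited and appreciable hyperreal, and let u be a hyperreal such that u²/δt − σ² is infinitesimal. Then u is infinitesimal. -/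
open Hyperreal

open ArchimedeanClass in
/-- If `δt` is a positive infinitesimal, `σ` is a positive limited appreciable hyperreal,
and the Heisenberg condition `u²/δt ≈ σ²` holds, then `u` is infinitesimal
(continuity of the quantum trajectory). -/
theorem heisenberg_increment_infinitesimal (δt σ u : ℝ*)
    (hδt_pos : 0 < δt) (hδt_inf : Infinitesimal δt)
    (hσ_pos : 0 < σ) (hσ_lim : ¬ σ.Infinite) (hσ_app : ¬ Infinitesimal σ)
    (hu : Infinitesimal (u ^ 2 / δt - σ ^ 2)) :
    Infinitesimal u := by
  rw [infinitesimal_iff] at *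
  rw [infinite_iff, not_lt] at hσ_lim
  have h_quot : 0 ≤ mk (u ^ 2 / δt - σ ^ 2 + σ ^ 2) := by
    refine (le_min hu.le ?_).trans (min_le_mk_add _ _)
    rw [mk_pow]
    exact nsmul_nonneg hσ_lim 2
  rw [sub_add_cancel] at h_quot
  have h_sq : 0 < mk (u ^ 2) := by
    rw [← div_mul_cancel₀ (u ^ 2) hδt_pos.ne', mk_mul]
    exact hδt_inf.trans_le (le_add_of_nonneg_left h_quot)
  rw [mk_pow] at h_sq
  contrapose! h_sq
  exact nsmul_nonpos h_sq 2
end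

section
/- Let δt be a positive infinitesimal hyperreal, let σ be a positive, limited and appreciable hyperreal, and let u be a hyperreal such that u²/δt − σ² is infinitesimal. Then u/δt is infinite (unlimited). -/
open Hyperreal

open ArchimedeanClass in
/-- If `δt` is a positive infinitesimal, `σ` is a positive limited appreciable hyperreal,
and the Heisenberg condition `u²/δt ≈ σ²` holds, then the difference quotient `u/δt` is
infinite (non-differentiability / Zitterbewegung of the quantum trajectory). -/
theorem heisenberg_difference_quotient_infinite (δt σ u : ℝ*)
    (hδt_pos : 0 < δt) (hδt_inf : Infinitesimal δt)
    (hσ_pos : 0 < σ) (hσ_lim : ¬ σ.Infinite) (hσ_app : ¬ Infinitesimal σ)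
    (hu : Infinitesimal (u ^ 2 / δt - σ ^ 2)) :
    (u / δt).Infinite := by
  rw [infinitesimal_iff] at hδt_inf hσ_app hu
  rw [infinite_iff]
  by_contra! hv
  have hquot : 0 < mk (u ^ 2 / δt) := by
    have h : u ^ 2 / δt = (u / δt) * (u / δt) * δt := by
      field_simp
    rw [h, mk_mul, mk_mul]
    exact hδt_inf.trans_le (le_add_of_nonneg_left (add_nonneg hv hv))
  have hσ_sq : 0 < mk (σ * σ) := by
    have h : σ * σ = u ^ 2 / δt - (u ^ 2 / δt - σ ^ 2) := by ring
    rw [h]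
    exact (lt_min hquot hu).trans_le (min_le_mk_sub _ _)
  rw [mk_mul] at hσ_sq
  exact hσ_sq.not_ge (add_nonpos (not_lt.1 hσ_app) (not_lt.1 hσ_app))
end

section
/- Let δt be a positive infinitesimal hyperreal and v the positive hyperreal with v² = δt. Let D be a limited hyperreal, s a positive, limited and appreciable hyperreal, and η ∈ {−1, 1}; set u = D·δt + s·η·v. If σ is a positive, limited and appreciable hyperreal such that u²/δt − σ² is infinitesimal, then σ − s is infinitesimal. -/
open Hyperreal

theorem Hyperreal.Infinitesimal.of_sq {x : ℝ*} (h : Infinitesimal (x ^ 2)) : Infinitesimal x := by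
  refine infinitesimal_def.2 fun r hr => abs_lt.1 (abs_lt_of_sq_lt_sq ?_ (coe_pos.2 hr).le)
  simpa only [sq, coe_mul] using lt_of_pos_of_infinitesimal h (r * r) (mul_pos hr hr)

theorem Hyperreal.Infinitesimal.sub_of_sq_sub_sq {x y : ℝ*} (hx : ¬ Infinite x)
    (hy : ¬ Infinite y) (hx0 : 0 ≤ x) (hy0 : 0 ≤ y) (h : Infinitesimal (x ^ 2 - y ^ 2)) :
    Infinitesimal (x - y) := by
  have hxs := isSt_st' hx
  have hys := isSt_st' hy
  have hst := (hxs.mul hxs).sub (hys.mul hys)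
  simp only [← sq] at hst
  have hsq : st x ^ 2 = st y ^ 2 := sub_eq_zero.1 (hst.unique h)
  have heq : st x = st y :=
    (sq_eq_sq₀ ((isSt_refl_real 0).le hxs hx0) ((isSt_refl_real 0).le hys hy0)).1 hsq
  simpa only [heq, sub_self, Infinitesimal] using hxs.sub hys

theorem Hyperreal.Infinitesimal.mul_not_infinite {x y : ℝ*} (hx : Infinitesimal x)
    (hy : ¬ Infinite y) : Infinitesimal (x * y) := by
  simpa only [zero_mul, Infinitesimal] using IsSt.mul hx (isSt_st' hy)

/-- If the increment `u = D·δt + s·eta·√δt` (limited drift `D`, positive limited appreciable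
`s`, sign `eta = ±1`) satisfies the Heisenberg condition `u²/δt ≈ σ²` for a positive limited
appreciable `σ`, then `σ ≈ s`. -/
theorem nelson_heisenberg_identification (δt v D s eta u σ : ℝ*)
    (hδt_pos : 0 < δt) (hδt_inf : Infinitesimal δt)
    (hv_pos : 0 < v) (hv_sq : v ^ 2 = δt)
    (hD_lim : ¬ D.Infinite)
    (hs_pos : 0 < s) (hs_lim : ¬ s.Infinite) (hs_app : ¬ Infinitesimal s)
    (heta : eta = -1 ∨ eta = 1)
    (hu : u = D * δt + s * eta * v)
    (hσ_pos : 0 < σ) (hσ_lim : ¬ σ.Infinite) (hσ_app : ¬ Infinitesimal σ)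
    (hH : Infinitesimal (u ^ 2 / δt - σ ^ 2)) :
    Infinitesimal (σ - s) := by
  have hv : Infinitesimal v := .of_sq (hv_sq ▸ hδt_inf)
  have heta_lim : ¬ eta.Infinite := by
    rcases heta with rfl | rfl
    · simpa using not_infinite_real (-1)
    · simpa using not_infinite_real 1
  have heta_sq : eta ^ 2 = 1 := by rcases heta with rfl | rfl <;> ring
  have hquot : u ^ 2 / δt = v * (D * (v * D + (s * eta + s * eta))) + s ^ 2 := by
    rw [hu, div_eq_iff hδt_pos.ne', ← hv_sq]
    linear_combination s ^ 2 * v ^ 2 * heta_sq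
  have hseta_lim := not_infinite_mul hs_lim heta_lim
  have herr : Infinitesimal (v * (D * (v * D + (s * eta + s * eta)))) :=
    hv.mul_not_infinite <| not_infinite_mul hD_lim <|
      not_infinite_add (not_infinite_mul hv.not_infinite hD_lim)
        (not_infinite_add hseta_lim hseta_lim)
  refine .sub_of_sq_sub_sq hσ_lim hs_lim hσ_pos.le hs_pos.le ?_
  convert herr.add hH.neg using 1
  rw [hquot]
  ring
end
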